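/- Let G=(V,w,m,d) be a salami with connected salami partition P=(X,Y,K), and let f ∈ ℋ(P). Then Δf(x) = 0 for all x ∈ V, and ∇₊f(x) = ∇₋f(x) = 1 for all x ∈ V. In particular, G admits a harmonic function of constant gradient one. -/

import Mathlib

open Filter

namespace SalamiPaper

variable {V : Type*}

/-- Locally finite: every vertex has finitely many neighbors. -/
def LocallyFinite (w : V → V → ℝ) : Prop := ∀ x : V, {y | 0 < w x y}.Finite

/-- Connectedness of the weighted graph: any two vertices are joined by a path. -/
def GraphConnected (w : V → V → ℝ) : Prop :=
  ∀ x y : V, Relation.ReflTransGen (fun a b => 0 < w a b) x y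

/-- The weighted graph Laplacian `Δf(x) = (1/m(x)) ∑_y w(x,y)(f(y)-f(x))`. -/
noncomputable def lap (w : V → V → ℝ) (m : V → ℝ) (f : V → ℝ) (x : V) : ℝ :=
  (m x)⁻¹ * ∑ᶠ y, w x y * (f y - f x)

/-- The vertex degree `Deg(x) = (1/m(x)) ∑_y w(x,y)`. -/
noncomputable def deg (w : V → V → ℝ) (m : V → ℝ) (x : V) : ℝ :=
  (m x)⁻¹ * ∑ᶠ y, w x y

/-- The set of `d`-lengths of adjacency paths from `x` to `y`. -/
def pathLens (w : V → V → ℝ) (d : V → V → ℝ) (x y : V) : Set ℝ :=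
  {L | ∃ (n : ℕ) (p : ℕ → V), p 0 = x ∧ p n = y ∧
    (∀ i < n, 0 < w (p i) (p (i + 1))) ∧
    L = ∑ i ∈ Finset.range n, d (p i) (p (i + 1))}

/-- `d` is a path metric on the graph with edge weight `w`. -/
def IsPathMetric (w : V → V → ℝ) (d : V → V → ℝ) : Prop :=
  (∀ x, d x x = 0) ∧ (∀ x y, x ≠ y → 0 < d x y) ∧ (∀ x y, d x y = d y x) ∧
  (∀ x y z, d x z ≤ d x y + d y z) ∧
  (∀ x y, d x y = sInf (pathLens w d x y))

/-- All balls are finite. -/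
def FiniteBalls (d : V → V → ℝ) : Prop := ∀ (x : V) (R : ℝ), {y | d x y ≤ R}.Finite

/-- The combinatorial graph distance (as a real number). -/
noncomputable def combDist (w : V → V → ℝ) (x y : V) : ℝ :=
  sInf {L | ∃ (n : ℕ) (p : ℕ → V), p 0 = x ∧ p n = y ∧
    (∀ i < n, 0 < w (p i) (p (i + 1))) ∧ L = (n : ℝ)}

/-- `Lip(1)`: the 1-Lipschitz functions with respect to `d`. -/
def Lip1 (d : V → V → ℝ) (f : V → ℝ) : Prop := ∀ x y, f y - f x ≤ d x y

/-- The Ollivier curvature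
`κ(x,y) = (1/d(x,y)) inf{Δf(x) - Δf(y) : f ∈ Lip(1), f(y)-f(x) = d(x,y)}`. -/
noncomputable def kappa (w : V → V → ℝ) (m : V → ℝ) (d : V → V → ℝ) (x y : V) : ℝ :=
  (d x y)⁻¹ * sInf {c | ∃ f : V → ℝ, Lip1 d f ∧ f y - f x = d x y ∧
    c = lap w m f x - lap w m f y}

/-- `m(A) = ∞`: the total measure of `A` is infinite. -/
def InfVolume (m : V → ℝ) (A : Set V) : Prop :=
  ∀ c : ℝ, ∃ F : Finset V, ↑F ⊆ A ∧ c < ∑ x ∈ F, m x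

/-- A salami partition `(X,Y,K)`. -/
def SalamiPartition (w : V → V → ℝ) (m : V → ℝ) (X Y K : Set V) : Prop :=
  X ∪ Y ∪ K = Set.univ ∧ Disjoint X Y ∧ Disjoint X K ∧ Disjoint Y K ∧
  K.Finite ∧ (∀ x ∈ X, ∀ y ∈ Y, w x y = 0) ∧ InfVolume m X ∧ InfVolume m Y

/-- Reachability inside a subset `A` of the vertex set. -/
def reachIn (w : V → V → ℝ) (A : Set V) : V → V → Prop :=
  Relation.ReflTransGen (fun a b => a ∈ A ∧ b ∈ A ∧ 0 < w a b)

/-- The induced subgraph on `A` is connected. -/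
def ConnectedIn (w : V → V → ℝ) (A : Set V) : Prop :=
  ∀ x ∈ A, ∀ y ∈ A, reachIn w A x y

/-- A connected salami partition: `K` induces a connected subgraph. -/
def ConnectedSalamiPartition (w : V → V → ℝ) (m : V → ℝ) (X Y K : Set V) : Prop :=
  SalamiPartition w m X Y K ∧ ConnectedIn w K

/-- The basic standing assumptions on a weighted graph `G = (V,w,m,d)`:
countable vertex set, symmetric non-negative edge weight vanishing on the diagonal,
positive vertex measure, local finiteness, connectedness,
`d` a path metric with finite balls. -/
def IsGraphBase (w : V → V → ℝ) (m : V → ℝ) (d : V → V → ℝ) : Prop :=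
  Countable V ∧ (∀ x y, w x y = w y x) ∧ (∀ x y, 0 ≤ w x y) ∧ (∀ x, w x x = 0) ∧
  (∀ x, 0 < m x) ∧ LocallyFinite w ∧ GraphConnected w ∧
  IsPathMetric w d ∧ FiniteBalls d

/-- Non-negative Ollivier curvature on all edges. -/
def NonnegCurv (w : V → V → ℝ) (m : V → ℝ) (d : V → V → ℝ) : Prop :=
  ∀ x y, 0 < w x y → 0 ≤ kappa w m d x y

/-- A salami: a connected, locally finite weighted graph with a path metric with
finite balls, non-negative Ollivier curvature, admitting a salami partition. -/
def IsSalami (w : V → V → ℝ) (m : V → ℝ) (d : V → V → ℝ) : Prop :=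
  IsGraphBase w m d ∧ NonnegCurv w m d ∧ ∃ X Y K : Set V, SalamiPartition w m X Y K

/-- `G` has at least `n` ends: there is a finite set `K` such that `V ∖ K` has at
least `n` infinite connected components. -/
def atLeastEnds (w : V → V → ℝ) (n : ℕ) : Prop :=
  ∃ K : Set V, K.Finite ∧ ∃ x : Fin n → V,
    (∀ i, x i ∉ K) ∧ (∀ i, {y | reachIn w Kᶜ (x i) y}.Infinite) ∧
    (∀ i j, i ≠ j → ¬ reachIn w Kᶜ (x i) (x j))

/-- `Lip(1,K)`: functions that are 1-Lipschitz on `K`. -/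
def Lip1On (d : V → V → ℝ) (K : Set V) (f : V → ℝ) : Prop :=
  ∀ x ∈ K, ∀ y ∈ K, f y - f x ≤ d x y

open Classical in
/-- The extremal Lipschitz extension operator `S(P)` of the salami partition
`P = (X,Y,K)`. -/
noncomputable def Sop (d : V → V → ℝ) (X Y K : Set V) (f : V → ℝ) : V → ℝ :=
  fun v =>
    if v ∈ K then f v
    else if v ∈ X then sSup {c | ∃ u ∈ K, c = f u - d v u}
    else sInf {c | ∃ u ∈ K, c = f u + d v u}

/-- `ℱ(P) = S(P)(Lip(1,K))`. -/
def calF (d : V → V → ℝ) (X Y K : Set V) : Set (V → ℝ) :=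
  {g | ∃ f : V → ℝ, Lip1On d K f ∧ g = Sop d X Y K f}

/-- `ℋ(P)`: the harmonic functions in `ℱ(P)`. -/
def calH (w : V → V → ℝ) (m : V → ℝ) (d : V → V → ℝ) (X Y K : Set V) :
    Set (V → ℝ) :=
  {g | g ∈ calF d X Y K ∧ ∀ x, lap w m g x = 0}

/-- `∇₊f(x) = max_{y∼x} (f(y)-f(x))/d(x,y)`. -/
noncomputable def gradPlus (w : V → V → ℝ) (d : V → V → ℝ) (f : V → ℝ) (x : V) : ℝ :=
  sSup {c | ∃ y, 0 < w x y ∧ c = (f y - f x) / d x y}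

/-- `∇₋f(x) = max_{y∼x} (f(x)-f(y))/d(x,y)`. -/
noncomputable def gradMinus (w : V → V → ℝ) (d : V → V → ℝ) (f : V → ℝ) (x : V) : ℝ :=
  sSup {c | ∃ y, 0 < w x y ∧ c = (f x - f y) / d x y}

/-- `|∇f|(x) = max_{y∼x} |f(y)-f(x)|/d(x,y)`. -/
noncomputable def gradAbs (w : V → V → ℝ) (d : V → V → ℝ) (f : V → ℝ) (x : V) : ℝ :=
  sSup {c | ∃ y, 0 < w x y ∧ c = |f y - f x| / d x y}

/-- Recurrence: for every `ε > 0` there is a finitely supported `f` with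
`‖f‖∞ = 1` and `-⟨f, Δf⟩ < ε`. -/
def Recurrent (w : V → V → ℝ) (m : V → ℝ) : Prop :=
  ∀ ε : ℝ, 0 < ε → ∃ f : V → ℝ, (Function.support f).Finite ∧
    (∀ x, |f x| ≤ 1) ∧ (∃ x, |f x| = 1) ∧
    -(∑ᶠ x, f x * lap w m f x * m x) < ε

open Classical in
/-- `∑_{x,y : f(y) < 0 ≤ f(x)} w(x,y)(f(x)-f(y))`. -/
noncomputable def cutSum (w : V → V → ℝ) (f : V → ℝ) : ℝ :=
  ∑ᶠ p : V × V, if f p.2 < 0 ∧ 0 ≤ f p.1 then w p.1 p.2 * (f p.1 - f p.2) else 0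

/-- Subexponential growth: `max_{B_r(x)} |u| = e^{o(r)}` as `r → ∞`. -/
def SubexpGrowth (d : V → V → ℝ) (x : V) (u : V → ℝ) : Prop :=
  Filter.Tendsto
    (fun r : ℕ => Real.log (sSup {c | ∃ y, d x y ≤ (r : ℝ) ∧ c = |u y|}) / (r : ℝ))
    Filter.atTop (nhds 0)


section Geodesics

variable {w : V → V → ℝ} {m : V → ℝ} {d : V → V → ℝ}

lemma pathLens_nonempty (h_conn : GraphConnected w) (x z : V) : (pathLens w d x z).Nonempty := by
  suffices ∃ (n : ℕ) (p : ℕ → V), p 0 = x ∧ p n = z ∧ ∀ i < n, 0 < w (p i) (p (i + 1)) by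
    obtain ⟨n, p, h0, hn, hp⟩ := this
    exact ⟨_, n, p, h0, hn, hp, rfl⟩
  induction h_conn x z using Relation.ReflTransGen.head_induction_on with
  | refl => exact ⟨0, fun _ => z, rfl, rfl, by simp⟩
  | @head a b hab _ ih =>
    obtain ⟨n, p, h0, hn, hp⟩ := ih
    refine ⟨n + 1, fun i => Nat.casesOn i a p, rfl, hn, ?_⟩
    rintro (_ | i) hi
    · simpa [h0] using hab
    · exact hp i (by omega)

lemma dist_le_path_length (h_zero : ∀ x, d x x = 0) (h_tri : ∀ x y z, d x z ≤ d x y + d y z)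
    (p : ℕ → V) (n : ℕ) : d (p 0) (p n) ≤ ∑ i ∈ Finset.range n, d (p i) (p (i + 1)) := by
  induction n with
  | zero => simp [h_zero]
  | succ n ih =>
    rw [Finset.sum_range_succ]
    linarith [h_tri (p 0) (p n) (p (n + 1))]

/-- Every geodesic can be started with an edge. -/
lemma exists_first_step (hG : IsGraphBase w m d) {x z : V} (hxz : x ≠ z) :
    ∃ y, 0 < w x y ∧ d x z = d x y + d y z := by
  obtain ⟨-, -, -, -, -, h_fin, h_conn, ⟨h_zero, -, -, h_tri, h_path⟩, -⟩ := hG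
  have key : ∀ L ∈ pathLens w d x z, ∃ y, 0 < w x y ∧ d x y + d y z ≤ L := by
    rintro L ⟨n, p, rfl, rfl, hp, rfl⟩
    cases n with
    | zero => exact absurd rfl hxz
    | succ n =>
      refine ⟨p 1, hp 0 (by omega), ?_⟩
      rw [Finset.sum_range_succ']
      linarith [dist_le_path_length h_zero h_tri (fun i => p (i + 1)) n]
  have h_nonempty := pathLens_nonempty (d := d) h_conn x z
  obtain ⟨L, hL⟩ := h_nonempty
  obtain ⟨y₁, hy₁, -⟩ := key L hL
  obtain ⟨y, hy, h_min⟩ :=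
    Set.exists_min_image {y | 0 < w x y} (fun y => d x y + d y z) (h_fin x) ⟨y₁, hy₁⟩
  refine ⟨y, hy, le_antisymm (h_tri x y z) ?_⟩
  rw [h_path x z]
  refine le_csInf ⟨L, hL⟩ fun L' hL' => ?_
  obtain ⟨y', hy', h_le⟩ := key L' hL'
  exact (h_min y' hy').trans h_le

/-- Induction along geodesics with a fixed endpoint. -/
lemma geodesic_induction (hG : IsGraphBase w m d) (z : V) (p : V → Prop) (h_end : p z)
    (h_step : ∀ x y, 0 < w x y → d x z = d x y + d y z → p y → p x) (x : V) : p x := by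
  induction hn : {v | d z v ≤ d z x}.ncard using Nat.strong_induction_on generalizing x with
  | _ n ih =>
    by_cases hxz : x = z
    · exact hxz ▸ h_end
    obtain ⟨y, hy, h_eq⟩ := exists_first_step hG hxz
    obtain ⟨-, -, -, h_loop, -, -, -, ⟨-, h_pos, h_symm, -, -⟩, h_ball⟩ := hG
    have hxy : x ≠ y := by
      rintro rfl
      exact hy.ne' (h_loop x)
    have h_lt : d z y < d z x := by
      linarith [h_pos x y hxy, h_symm z y, h_symm z x]
    refine h_step x y hy h_eq (ih _ ?_ y rfl)
    rw [← hn]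
    refine Set.ncard_lt_ncard ⟨fun v hv => le_trans hv h_lt.le, fun h => ?_⟩ (h_ball z _)
    exact absurd (h (show d z x ≤ d z x from le_rfl)) (not_le.mpr h_lt)

end Geodesics

section Laplacian

variable {w : V → V → ℝ} {m : V → ℝ} {d : V → V → ℝ} {f : V → ℝ}

lemma lap_eq_sum (h_nonneg : ∀ x y, 0 ≤ w x y) (h_fin : LocallyFinite w) (f : V → ℝ) (x : V) :
    lap w m f x = (m x)⁻¹ * ∑ y ∈ (h_fin x).toFinset, w x y * (f y - f x) := by
  rw [lap, finsum_eq_sum_of_support_subset]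
  intro y hy
  have : w x y ≠ 0 := left_ne_zero_of_mul hy
  simpa using lt_of_le_of_ne (h_nonneg x y) this.symm

lemma lap_neg (hG : IsGraphBase w m d) (f : V → ℝ) (x : V) :
    lap w m (fun v => -f v) x = -lap w m f x := by
  obtain ⟨-, -, h_nonneg, -, -, h_fin, -⟩ := hG
  rw [lap_eq_sum h_nonneg h_fin, lap_eq_sum h_nonneg h_fin, ← mul_neg, ← Finset.sum_neg_distrib]
  congr 1
  exact Finset.sum_congr rfl fun y _ => by ring

lemma Lip1.neg (h_symm : ∀ x y, d x y = d y x) (hf : Lip1 d f) : Lip1 d (fun v => -f v) :=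
  fun x y => by linarith [hf y x, h_symm x y]

lemma abs_lap_le (hG : IsGraphBase w m d) (hf : Lip1 d f) (x : V) :
    |lap w m f x| ≤ lap w m (d x) x := by
  obtain ⟨-, -, h_nonneg, -, h_m, h_fin, -, ⟨h_zero, -, h_symm, -⟩, -⟩ := hG
  rw [lap_eq_sum h_nonneg h_fin, lap_eq_sum h_nonneg h_fin, abs_mul,
    abs_of_pos (inv_pos.mpr (h_m x))]
  refine mul_le_mul_of_nonneg_left ?_ (inv_pos.mpr (h_m x)).le
  refine (Finset.abs_sum_le_sum_abs _ _).trans (Finset.sum_le_sum fun y _ => ?_)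
  rw [abs_mul, abs_of_nonneg (h_nonneg x y), h_zero, sub_zero]
  refine mul_le_mul_of_nonneg_left (abs_le.mpr ⟨?_, hf x y⟩) (h_nonneg x y)
  linarith [hf y x, h_symm x y]

/-- Non-negative curvature makes the Laplacian of a Lipschitz function monotone along edges of
maximal slope. -/
lemma lap_le_lap_of_nonnegCurv (hG : IsGraphBase w m d) (h_curv : NonnegCurv w m d)
    (hf : Lip1 d f) {x y : V} (hxy : 0 < w x y) (h_eq : f y - f x = d x y) :
    lap w m f y ≤ lap w m f x := by
  have h_pos : 0 < d x y := by
    refine hG.2.2.2.2.2.2.2.1.2.1 x y ?_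
    rintro rfl
    exact hxy.ne' (hG.2.2.2.1 x)
  have h_sInf := nonneg_of_mul_nonneg_right (h_curv x y hxy) (inv_pos.mpr h_pos)
  refine sub_nonneg.mp (h_sInf.trans (csInf_le ⟨-lap w m (d x) x - lap w m (d y) y, ?_⟩
    ⟨f, hf, h_eq, rfl⟩))
  rintro _ ⟨g, hg, -, rfl⟩
  linarith [neg_le_of_abs_le (abs_lap_le hG hg x), le_of_abs_le (abs_lap_le hG hg y)]

/-- Along an edge of maximal slope, each neighbor of the lower endpoint is transported with
maximal slope into the unit ball of the upper endpoint. -/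
lemma exists_transport_edge (hG : IsGraphBase w m d) (h_curv : NonnegCurv w m d)
    (hf : Lip1 d f) (h_harm : ∀ x, lap w m f x = 0) {x y u : V} (hxy : 0 < w x y)
    (h_eq : f y - f x = d x y) (hu : u = x ∨ 0 < w x u) :
    ∃ v, (v = y ∨ 0 < w y v) ∧ f v - f u = d u v := by
  rcases hu with rfl | hu
  · exact ⟨y, Or.inl rfl, h_eq⟩
  by_contra! h_none
  have hG' := hG
  obtain ⟨-, h_wsymm, h_nonneg, -, h_m, h_fin, -, ⟨h_zero, -, h_symm, h_tri, -⟩, -⟩ := hG'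
  have h_slack : ∀ v, (v = y ∨ 0 < w y v) → 0 < f u + d u v - f v := fun v hv => by
    have := lt_of_le_of_ne (hf u v) (h_none v hv)
    linarith
  have h_ball_fin : {v | v = y ∨ 0 < w y v}.Finite := (Set.finite_singleton y).union (h_fin y)
  obtain ⟨v₀, hv₀, h_min⟩ := Set.exists_min_image {v | v = y ∨ 0 < w y v}
    (fun v => f u + d u v - f v) h_ball_fin ⟨y, Or.inl rfl⟩
  set ε := f u + d u v₀ - f v₀ with hε
  have hε_pos : 0 < ε := h_slack v₀ hv₀
  let g : V → ℝ := fun v => min (f v) (f u - ε + d u v)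
  have hg_le : ∀ v, g v ≤ f v := fun v => min_le_left _ _
  have hg_eq : ∀ v, (v = y ∨ 0 < w y v) → g v = f v := fun v hv =>
    min_eq_left (by linarith [h_min v hv])
  have hgu : g u < f u := (min_le_right _ _).trans_lt (by rw [h_zero]; linarith)
  have hg : Lip1 d g := fun a b => by
    have h1 := hf a b
    have h2 := h_tri u a b
    rcases min_choice (f a) (f u - ε + d u a) with h | h
    · change min _ _ - min _ _ ≤ _
      rw [h]
      linarith [min_le_left (f b) (f u - ε + d u b)]
    · change min _ _ - min _ _ ≤ _
      rw [h]
      linarith [min_le_right (f b) (f u - ε + d u b)]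
  have hgx : g x = f x := hg_eq x (Or.inr (h_wsymm x y ▸ hxy))
  have hgy : g y = f y := hg_eq y (Or.inl rfl)
  have h_lap_y : lap w m g y = lap w m f y := by
    rw [lap_eq_sum h_nonneg h_fin, lap_eq_sum h_nonneg h_fin, hgy]
    congr 1
    refine Finset.sum_congr rfl fun v hv => ?_
    rw [hg_eq v (Or.inr (by simpa using hv))]
  have h_lap_x : lap w m g x < lap w m f x := by
    rw [lap_eq_sum h_nonneg h_fin, lap_eq_sum h_nonneg h_fin, hgx]
    refine mul_lt_mul_of_pos_left (Finset.sum_lt_sum (fun v _ => ?_) ⟨u, by simpa using hu, ?_⟩)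
      (inv_pos.mpr (h_m x))
    · exact mul_le_mul_of_nonneg_left (by linarith [hg_le v]) (h_nonneg x v)
    · exact mul_lt_mul_of_pos_left (by linarith) hu
  have h_mono := lap_le_lap_of_nonnegCurv hG h_curv hg hxy (by rw [hgx, hgy, h_eq])
  linarith [h_harm x, h_harm y]

/-- The global form of `exists_transport_edge`. -/
lemma exists_transport (hG : IsGraphBase w m d) (h_curv : NonnegCurv w m d)
    (hf : Lip1 d f) (h_harm : ∀ x, lap w m f x = 0) {x z : V} (h_eq : f z - f x = d x z)
    {u : V} (hu : u = x ∨ 0 < w x u) :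
    ∃ v, (v = z ∨ 0 < w z v) ∧ f v - f u = d u v := by
  have h_tri := hG.2.2.2.2.2.2.2.1.2.2.2.1
  have h_zero := hG.2.2.2.2.2.2.2.1.1
  refine geodesic_induction hG z (fun x => f z - f x = d x z → ∀ u, (u = x ∨ 0 < w x u) →
    ∃ v, (v = z ∨ 0 < w z v) ∧ f v - f u = d u v) ?_ ?_ x h_eq u hu
  · exact fun _ u hu => ⟨u, hu, by simp [h_zero]⟩
  · intro x y hxy h_geo ih h_eq u hu
    have h1 := hf x y
    have h2 := hf y z
    obtain ⟨v, hv, h_uv⟩ :=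
      exists_transport_edge hG h_curv hf h_harm hxy (by linarith) hu
    obtain ⟨v', hv', h_vv'⟩ := ih (by linarith) v hv
    exact ⟨v', hv', le_antisymm (hf u v') (by linarith [h_tri u v v'])⟩

/-- If infinitely many vertices lie above one vertex at maximal slope, then the same holds for
every vertex, and the upper gradient is constantly one. -/
lemma gradPlus_eq_one (hG : IsGraphBase w m d) (h_curv : NonnegCurv w m d)
    (hf : Lip1 d f) (h_harm : ∀ x, lap w m f x = 0) {x₀ : V}
    (h_inf : {z | f z - f x₀ = d x₀ z}.Infinite) (x : V) : gradPlus w d f x = 1 := by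
  have hG' := hG
  obtain ⟨-, h_wsymm, -, h_loop, -, h_fin, h_conn, ⟨-, h_pos, -⟩, -⟩ := hG'
  have h_inf_x : {z | f z - f x = d x z}.Infinite := by
    induction h_conn x₀ x with
    | refl => exact h_inf
    | @tail a b _ hab ih =>
      intro h_finite
      refine ih ((h_finite.biUnion fun v _ =>
        (Set.finite_singleton v).union (h_fin v)).subset fun z hz => ?_)
      obtain ⟨v, hv, h_bv⟩ := exists_transport hG h_curv hf h_harm hz (Or.inr hab)
      simp only [Set.mem_iUnion]
      refine ⟨v, h_bv, hv.imp Eq.symm fun h => ?_⟩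
      rwa [Set.mem_ofPred_eq, h_wsymm]
  have h_adj : ∀ y, 0 < w x y → 0 < d x y := fun y hy => h_pos x y (by
    rintro rfl
    exact hy.ne' (h_loop x))
  obtain ⟨z, hz, hzx⟩ := h_inf_x.exists_notMem_finite (Set.finite_singleton x)
  obtain ⟨y, hy, h_geo⟩ := exists_first_step hG (x := x) (z := z) fun h => hzx h.symm
  have h_slope : f y - f x = d x y := by
    have hz' : f z - f x = d x z := hz
    linarith [hf x y, hf y z]
  refine IsGreatest.csSup_eq ⟨⟨y, hy, ?_⟩, ?_⟩
  · rw [h_slope, div_self (h_adj y hy).ne']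
  · rintro _ ⟨v, hv, rfl⟩
    exact (div_le_one (h_adj v hv)).mpr (hf x v)

end Laplacian

section Extension

variable {w : V → V → ℝ} {m : V → ℝ} {d : V → V → ℝ} {X Y K : Set V}

lemma InfVolume.infinite {A : Set V} (h_m : ∀ x, 0 < m x) (hA : InfVolume m A) :
    A.Infinite := by
  intro h_fin
  obtain ⟨F, hF, h_lt⟩ := hA (∑ x ∈ h_fin.toFinset, m x)
  refine h_lt.not_ge (Finset.sum_le_sum_of_subset_of_nonneg (fun x hx => ?_)
    fun x _ _ => (h_m x).le)
  simpa using hF hx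

/-- Geodesics from `X` to `Y` pass through `K`. -/
lemma SalamiPartition.exists_between (hG : IsGraphBase w m d) (hP : SalamiPartition w m X Y K)
    {x y : V} (hx : x ∈ X) (hy : y ∈ Y) : ∃ u ∈ K, d x y = d x u + d u y := by
  obtain ⟨h_cover, h_XY, -, -, -, h_sep, -⟩ := hP
  have h_tri := hG.2.2.2.2.2.2.2.1.2.2.2.1
  refine geodesic_induction hG y (fun x => x ∈ X → ∃ u ∈ K, d x y = d x u + d u y) ?_ ?_ x hx
  · exact fun h => absurd hy (Set.disjoint_left.mp h_XY h)
  · intro a b hab h_geo ih ha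
    rcases (h_cover ▸ Set.mem_univ b : b ∈ X ∪ Y ∪ K) with (hb | hb) | hb
    · obtain ⟨u, hu, h_eq⟩ := ih hb
      exact ⟨u, hu, le_antisymm (h_tri a u y) (by linarith [h_tri a b u])⟩
    · exact absurd (h_sep a ha b hb) hab.ne'
    · exact ⟨b, hb, h_geo⟩

lemma SalamiPartition.K_nonempty (hG : IsGraphBase w m d) (hP : SalamiPartition w m X Y K) :
    K.Nonempty := by
  have hP' := hP
  obtain ⟨-, -, -, -, -, -, hX, hY⟩ := hP'
  have h_m := hG.2.2.2.2.1
  obtain ⟨x, hx⟩ := (hX.infinite h_m).nonempty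
  obtain ⟨y, hy⟩ := (hY.infinite h_m).nonempty
  obtain ⟨u, hu, -⟩ := hP.exists_between hG hx hy
  exact ⟨u, hu⟩

lemma isGreatest_of_mem_calF (hG : IsGraphBase w m d) (hP : SalamiPartition w m X Y K)
    {f : V → ℝ} (hf : f ∈ calF d X Y K) {v : V} (hv : v ∉ Y) :
    IsGreatest ((fun u => f u - d v u) '' K) (f v) := by
  obtain ⟨g, hg, rfl⟩ := hf
  have hK := hP.K_nonempty hG
  obtain ⟨h_cover, -, -, -, h_fin, -⟩ := hP
  have h_on : ∀ u ∈ K, Sop d X Y K g u = g u := fun u hu => if_pos hu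
  have h_image : (fun u => Sop d X Y K g u - d v u) '' K = (fun u => g u - d v u) '' K :=
    Set.image_congr fun u hu => by rw [h_on u hu]
  rw [h_image]
  by_cases hvK : v ∈ K
  · rw [h_on v hvK]
    refine ⟨⟨v, hvK, by simp [hG.2.2.2.2.2.2.2.1.1 v]⟩, ?_⟩
    rintro _ ⟨u, hu, rfl⟩
    exact sub_le_comm.mp (hg v hvK u hu)
  · have hvX : v ∈ X := by
      rcases (h_cover ▸ Set.mem_univ v : v ∈ X ∪ Y ∪ K) with (h | h) | h
      exacts [h, absurd h hv, absurd h hvK]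
    have h_val : Sop d X Y K g v = sSup ((fun u => g u - d v u) '' K) := by
      rw [Sop, if_neg hvK, if_pos hvX]
      congr 1
      ext c
      simp [eq_comm]
    rw [h_val]
    exact ⟨(hK.image _).csSup_mem (h_fin.image _),
      fun c hc => le_csSup (h_fin.image _).bddAbove hc⟩

lemma isLeast_of_mem_calF (hG : IsGraphBase w m d) (hP : SalamiPartition w m X Y K)
    {f : V → ℝ} (hf : f ∈ calF d X Y K) {v : V} (hv : v ∉ X) :
    IsLeast ((fun u => f u + d v u) '' K) (f v) := by
  obtain ⟨g, hg, rfl⟩ := hf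
  have hK := hP.K_nonempty hG
  obtain ⟨-, -, -, -, h_fin, -⟩ := hP
  have h_on : ∀ u ∈ K, Sop d X Y K g u = g u := fun u hu => if_pos hu
  have h_image : (fun u => Sop d X Y K g u + d v u) '' K = (fun u => g u + d v u) '' K :=
    Set.image_congr fun u hu => by rw [h_on u hu]
  have ⟨h_zero, _, h_symm, _⟩ := hG.2.2.2.2.2.2.2.1
  rw [h_image]
  by_cases hvK : v ∈ K
  · rw [h_on v hvK]
    refine ⟨⟨v, hvK, by simp [h_zero v]⟩, ?_⟩
    rintro _ ⟨u, hu, rfl⟩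
    linarith [hg u hu v hvK, h_symm u v]
  · have h_val : Sop d X Y K g v = sInf ((fun u => g u + d v u) '' K) := by
      rw [Sop, if_neg hvK, if_neg hv]
      congr 1
      ext c
      simp [eq_comm]
    rw [h_val]
    exact ⟨(hK.image _).csInf_mem (h_fin.image _),
      fun c hc => csInf_le (h_fin.image _).bddBelow hc⟩

lemma lip1_of_mem_calF (hG : IsGraphBase w m d) (hP : SalamiPartition w m X Y K)
    {f : V → ℝ} (hf : f ∈ calF d X Y K) : Lip1 d f := by
  have ⟨_, _, h_symm, h_tri, _⟩ := hG.2.2.2.2.2.2.2.1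
  have h_XY := Set.disjoint_left.mp hP.2.1
  have h_YK := Set.disjoint_left.mp hP.2.2.2.1
  have h_XK := Set.disjoint_left.mp hP.2.2.1
  have h_lower : ∀ a ∉ Y, ∀ b ∉ Y, f b - f a ≤ d a b := fun a ha b hb => by
    obtain ⟨⟨u, hu, h_eq⟩, -⟩ := isGreatest_of_mem_calF hG hP hf hb
    have h_le := (isGreatest_of_mem_calF hG hP hf ha).2 ⟨u, hu, rfl⟩
    dsimp only at h_eq h_le
    linarith [h_tri a b u]
  have h_upper : ∀ a ∉ X, ∀ b ∉ X, f b - f a ≤ d a b := fun a ha b hb => by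
    obtain ⟨⟨u, hu, h_eq⟩, -⟩ := isLeast_of_mem_calF hG hP hf ha
    have h_le := (isLeast_of_mem_calF hG hP hf hb).2 ⟨u, hu, rfl⟩
    dsimp only at h_eq h_le
    linarith [h_tri b a u, h_symm a b]
  intro a b
  by_cases haY : a ∈ Y <;> by_cases hbY : b ∈ Y
  · exact h_upper a (fun h => h_XY h haY) b (fun h => h_XY h hbY)
  · by_cases hbX : b ∈ X
    · obtain ⟨u, hu, h_eq⟩ := hP.exists_between hG hbX haY
      linarith [h_lower u (fun h => h_YK h hu) b hbY,
        h_upper a (fun h => h_XY h haY) u (fun h => h_XK h hu), h_symm a b, h_symm a u, h_symm u b]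
    · exact h_upper a (fun h => h_XY h haY) b hbX
  · by_cases haX : a ∈ X
    · obtain ⟨u, hu, h_eq⟩ := hP.exists_between hG haX hbY
      linarith [h_lower a haY u (fun h => h_YK h hu),
        h_upper u (fun h => h_XK h hu) b (fun h => h_XY h hbY)]
    · exact h_upper a haX b (fun h => h_XY h hbY)
  · exact h_lower a haY b hbY

lemma exists_infinite_of_forall_exists {A : Set V} (hA : A.Infinite) (hK : K.Finite)
    {r : V → V → Prop} (h : ∀ v ∈ A, ∃ u ∈ K, r u v) : ∃ u, {v | r u v}.Infinite := by
  by_contra! h_fin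
  refine hA ((hK.biUnion fun u _ => h_fin u).subset fun v hv => ?_)
  obtain ⟨u, hu, h_uv⟩ := h v hv
  simp only [Set.mem_iUnion]
  exact ⟨u, hu, h_uv⟩

end Extension

/-- **Theorem (Harmonic functions of constant gradient).** If `f ∈ ℋ(P)` for a
connected salami partition `P`, then `Δf = 0` everywhere and
`∇₊f = ∇₋f = 1` everywhere. -/
theorem salami_const_gradient {V : Type*} (w : V → V → ℝ) (m : V → ℝ)
    (d : V → V → ℝ) (hS : IsSalami w m d) (X Y K : Set V)
    (hP : ConnectedSalamiPartition w m X Y K)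
    (f : V → ℝ) (hf : f ∈ calH w m d X Y K) :
    (∀ x, lap w m f x = 0) ∧
    (∀ x, gradPlus w d f x = 1 ∧ gradMinus w d f x = 1) := by
  obtain ⟨hG, h_curv, -⟩ := hS
  obtain ⟨h_mem, h_harm⟩ := hf
  have hP := hP.1
  have h_lip := lip1_of_mem_calF hG hP h_mem
  have h_m := hG.2.2.2.2.1
  have h_symm := hG.2.2.2.2.2.2.2.1.2.2.1
  have ⟨_, h_XY, _, _, h_fin, _, hX, hY⟩ := hP
  obtain ⟨x₁, h_up⟩ : ∃ u, {v | f v - f u = d u v}.Infinite := by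
    refine exists_infinite_of_forall_exists (hY.infinite h_m) h_fin fun v hv => ?_
    obtain ⟨⟨u, hu, h_eq⟩, -⟩ :=
      isLeast_of_mem_calF hG hP h_mem (Set.disjoint_right.mp h_XY hv)
    dsimp only at h_eq
    exact ⟨u, hu, by linarith [h_symm u v]⟩
  obtain ⟨x₂, h_down⟩ : ∃ u, {v | -f v - -f u = d u v}.Infinite := by
    refine exists_infinite_of_forall_exists (hX.infinite h_m) h_fin fun v hv => ?_
    obtain ⟨⟨u, hu, h_eq⟩, -⟩ :=
      isGreatest_of_mem_calF hG hP h_mem (Set.disjoint_left.mp h_XY hv)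
    dsimp only at h_eq
    exact ⟨u, hu, by linarith [h_symm u v]⟩
  refine ⟨h_harm, fun x => ⟨gradPlus_eq_one hG h_curv h_lip h_harm h_up x, ?_⟩⟩
  have h_neg := gradPlus_eq_one hG h_curv (h_lip.neg h_symm)
    (fun x => by rw [lap_neg hG, h_harm, neg_zero]) h_down x
  rw [← h_neg, gradMinus, gradPlus]
  simp only [neg_sub_neg]

end SalamiPaper
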